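/- Let (X,T) be a transitive topological dynamical system. Then (X,T) is disjoint from every minimal topological dynamical system if and only if (X,T) is weakly mixing and there exists a countable dense subset D of X consisting of minimal points of (X,T) such that for every minimal t.d.s. (Y,S), every point y ∈ Y, every open neighbourhood V of y, and every nonempty open set U ⊆ X, there is a point x ∈ D ∩ U for which the set N_{T×S}((x,y), U×V) = {n ∈ ℤ₊ : T^n x ∈ U and S^n y ∈ V} is syndetic. -/

import Mathlib

open Set Function Filter Topology

structure TDS where
  carrier : Type
  [ms : MetricSpace carrier]
  [cs : CompactSpace carrier]
  map : carrier → carrier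
  cont : Continuous map
  surj : Function.Surjective map

attribute [instance] TDS.ms TDS.cs

def orbit {X : Type*} (T : X → X) (x : X) : Set X :=
  Set.range fun n : ℕ => T^[n] x

def IsMinimalSys {Y : Type*} [TopologicalSpace Y] (S : Y → Y) : Prop :=
  ∀ y : Y, Dense (orbit S y)

def IsTransitiveSys {X : Type*} [TopologicalSpace X] (T : X → X) : Prop :=
  ∀ U V : Set X, IsOpen U → IsOpen V → U.Nonempty → V.Nonempty →
    {n : ℕ | (U ∩ T^[n] ⁻¹' V).Nonempty}.Infinite

def IsWeaklyMixingSys {X : Type*} [TopologicalSpace X] (T : X → X) : Prop :=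
  IsTransitiveSys fun p : X × X => (T p.1, T p.2)

def IsJoining {X Y : Type*} [TopologicalSpace X] [TopologicalSpace Y]
    (T : X → X) (S : Y → Y) (J : Set (X × Y)) : Prop :=
  J.Nonempty ∧ IsClosed J ∧ (∀ p ∈ J, (T p.1, S p.2) ∈ J) ∧
    Prod.fst '' J = Set.univ ∧ Prod.snd '' J = Set.univ

def DisjointSys {X Y : Type*} [TopologicalSpace X] [TopologicalSpace Y]
    (T : X → X) (S : Y → Y) : Prop :=
  ∀ J : Set (X × Y), IsJoining T S J → J = Set.univ

def Syndetic (A : Set ℕ) : Prop :=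
  ∃ N : ℕ, ∀ i : ℕ, ∃ j ≤ N, i + j ∈ A

def Thick (A : Set ℕ) : Prop :=
  ∀ L : ℕ, ∃ n : ℕ, ∀ j ≤ L, n + j ∈ A

def IsMinimalPoint {X : Type*} [TopologicalSpace X] (T : X → X) (x : X) : Prop :=
  ∀ y ∈ closure (orbit T x), closure (orbit T x) ⊆ closure (orbit T y)

def Proximal {X : Type*} [MetricSpace X] (T : X → X) (x y : X) : Prop :=
  ∃ u : ℕ → ℕ, Filter.Tendsto (fun i => dist (T^[u i] x) (T^[u i] y)) Filter.atTop (nhds 0)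

def IsDistalPoint {X : Type*} [MetricSpace X] (T : X → X) (x : X) : Prop :=
  ∀ y ∈ closure (orbit T x), Proximal T x y → y = x

def DynSyndetic (B : Set ℕ) : Prop :=
  ∃ 𝒴 : TDS, IsMinimalSys 𝒴.map ∧
    ∃ (y : 𝒴.carrier) (V : Set 𝒴.carrier),
      IsOpen V ∧ y ∈ V ∧ {n : ℕ | 𝒴.map^[n] y ∈ V} ⊆ B

def CentralSet (S : Set ℕ) : Prop :=
  ∃ 𝒵 : TDS, ∃ (z w : 𝒵.carrier) (W : Set 𝒵.carrier),
    IsMinimalPoint 𝒵.map w ∧ Proximal 𝒵.map z w ∧ IsOpen W ∧ w ∈ W ∧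
    {n : ℕ | 𝒵.map^[n] z ∈ W} ⊆ S

def CStarSet (A : Set ℕ) : Prop :=
  ∀ S : Set ℕ, CentralSet S → (A ∩ S).Nonempty

section Dynamics

variable {X : Type*} [TopologicalSpace X] {T : X → X}

lemma self_mem_closure_orbit (T : X → X) (x : X) : x ∈ closure (orbit T x) :=
  subset_closure ⟨0, rfl⟩

lemma mapsTo_closure_orbit (hT : Continuous T) (x : X) :
    MapsTo T (closure (orbit T x)) (closure (orbit T x)) := by
  refine MapsTo.closure ?_ hT
  rintro _ ⟨n, rfl⟩
  exact ⟨n + 1, iterate_succ_apply' T n x⟩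

lemma closure_orbit_subset {Z : Set X} (hZ : IsClosed Z) (hinv : MapsTo T Z Z) {x : X}
    (hx : x ∈ Z) : closure (orbit T x) ⊆ Z :=
  closure_minimal (range_subset_iff.2 fun n => hinv.iterate n hx) hZ

lemma IsMinimalPoint.of_mem_closure_orbit (hT : Continuous T) {x z : X} (hx : IsMinimalPoint T x)
    (hz : z ∈ closure (orbit T x)) : IsMinimalPoint T z := fun _ hy =>
  have hsub := closure_orbit_subset isClosed_closure (mapsTo_closure_orbit hT x) hz
  hsub.trans (hx _ (hsub hy))

lemma exists_isMinimalPoint_mem [CompactSpace X] {Z : Set X} (hT : Continuous T)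
    (hZ : IsClosed Z) (hne : Z.Nonempty) (hinv : MapsTo T Z Z) :
    ∃ x ∈ Z, IsMinimalPoint T x := by
  obtain ⟨K, hKZ, hK⟩ := zorn_superset_nonempty
    {K : Set X | IsClosed K ∧ K.Nonempty ∧ MapsTo T K K} (by
      intro c hc hchain hcne
      refine ⟨⋂₀ c, ⟨isClosed_sInter fun s hs => (hc hs).1, ?_, ?_⟩,
        fun s hs => sInter_subset_of_mem hs⟩
      · have := hcne.to_subtype
        rw [sInter_eq_iInter]
        refine IsCompact.nonempty_iInter_of_directed_nonempty_isCompact_isClosed _ ?_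
          (fun s => (hc s.2).2.1) (fun s => (hc s.2).1.isCompact) (fun s => (hc s.2).1)
        intro a b
        rcases hchain.total a.2 b.2 with h | h
        · exact ⟨a, subset_rfl, h⟩
        · exact ⟨b, h, subset_rfl⟩
      · intro x hx s hs
        exact (hc hs).2.2 (hx s hs)) Z ⟨hZ, hne, hinv⟩
  obtain ⟨hKc, ⟨x, hx⟩, hKinv⟩ := hK.prop
  refine ⟨x, hKZ hx, fun y hy => ?_⟩
  have hxK := closure_orbit_subset hKc hKinv hx
  have hyK := closure_orbit_subset hKc hKinv (hxK hy)
  exact hxK.trans (hK.le_of_le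
    ⟨isClosed_closure, ⟨y, self_mem_closure_orbit T y⟩, mapsTo_closure_orbit hT y⟩ hyK)

/-- The orbit closure of a minimal point, as a minimal system. -/
lemma IsMinimalPoint.exists_minimal_system {X : Type} [MetricSpace X] [CompactSpace X]
    {T : X → X} (hT : Continuous T) {x : X} (hx : IsMinimalPoint T x) :
    ∃ 𝒴 : TDS, IsMinimalSys 𝒴.map ∧ ∃ (π : 𝒴.carrier → X) (y : 𝒴.carrier), Continuous π ∧
      (∀ z (n : ℕ), π (𝒴.map^[n] z) = T^[n] (π z)) ∧ π y = x := by
  set Y := closure (orbit T x) with hY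
  have hinv : MapsTo T Y Y := mapsTo_closure_orbit hT x
  have : CompactSpace Y := isCompact_iff_compactSpace.1 isClosed_closure.isCompact
  set S : Y → Y := hinv.restrict T Y Y with hS
  have hSc : Continuous S := hT.restrict hinv
  have hiter : ∀ (z : Y) (n : ℕ), ((S^[n] z : Y) : X) = T^[n] z := fun z n =>
    (show Semiconj Subtype.val S T from fun _ => rfl).iterate_right n z
  have hmin : IsMinimalSys S := by
    intro z w
    rw [closure_subtype]
    have himage : ((↑) : Y → X) '' orbit S z = orbit T (z : X) := by
      rw [orbit, orbit, ← range_comp]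
      exact congrArg range (funext fun n => hiter z n)
    rw [himage]
    exact hx z z.2 w.2
  have hsurj : Surjective S := by
    rw [← range_eq_univ, ← (isCompact_range hSc).isClosed.closure_eq, ← dense_iff_closure_eq]
    refine (hmin (S ⟨x, self_mem_closure_orbit T x⟩)).mono ?_
    rintro _ ⟨n, rfl⟩
    exact ⟨S^[n] ⟨x, self_mem_closure_orbit T x⟩,
      (iterate_succ_apply' S n _).symm.trans (iterate_succ_apply S n _)⟩
  exact ⟨⟨Y, S, hSc, hsurj⟩, hmin, Subtype.val, ⟨x, self_mem_closure_orbit T x⟩,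
    continuous_subtype_val, hiter, rfl⟩

end Dynamics

/-- The points `x` such that some orbit `(x, y)` of the product never enters `U ×ˢ V`. -/
def avoiders {X Y : Type*} (T : X → X) (S : Y → Y) (U : Set X) (V : Set Y) : Set X :=
  {x | ∃ y, ∀ n : ℕ, ¬ (T^[n] x ∈ U ∧ S^[n] y ∈ V)}

lemma mapsTo_avoiders {X Y : Type*} {T : X → X} {S : Y → Y} {U : Set X} {V : Set Y} :
    MapsTo T (avoiders T S U V) (avoiders T S U V) := by
  rintro x ⟨y, hy⟩
  exact ⟨S y, fun n => by simpa only [← iterate_succ_apply] using hy (n + 1)⟩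

section Avoiders

variable {X Y : Type*} [TopologicalSpace X] [TopologicalSpace Y] {T : X → X} {S : Y → Y}
  {U : Set X} {V : Set Y}

lemma isClosed_avoiding_pairs (hT : Continuous T) (hS : Continuous S) (hU : IsOpen U)
    (hV : IsOpen V) : IsClosed {p : X × Y | ∀ n : ℕ, ¬ (T^[n] p.1 ∈ U ∧ S^[n] p.2 ∈ V)} := by
  simp only [ofPred_forall]
  refine isClosed_iInter fun n => isOpen_compl_iff.1 ?_
  have h : {p : X × Y | ¬ (T^[n] p.1 ∈ U ∧ S^[n] p.2 ∈ V)}ᶜ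
      = (T^[n] ⁻¹' U) ×ˢ (S^[n] ⁻¹' V) := by
    ext p
    simp
  rw [h]
  exact (hU.preimage (hT.iterate n)).prod (hV.preimage (hS.iterate n))

lemma isClosed_avoiders [CompactSpace Y] (hT : Continuous T)
    (hS : Continuous S) (hU : IsOpen U) (hV : IsOpen V) : IsClosed (avoiders T S U V) := by
  have h : avoiders T S U V =
      Prod.fst '' {p : X × Y | ∀ n : ℕ, ¬ (T^[n] p.1 ∈ U ∧ S^[n] p.2 ∈ V)} := by
    ext x
    simp [avoiders]
  rw [h]
  exact isClosedMap_fst_of_compactSpace _ (isClosed_avoiding_pairs hT hS hU hV)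

lemma avoiders_ne_univ [CompactSpace X] [T2Space Y] (hT : Continuous T)
    (hS : Continuous S) (hmin : IsMinimalSys S) (hdisj : DisjointSys T S) (hU : IsOpen U)
    (hV : IsOpen V) (hUne : U.Nonempty) (hVne : V.Nonempty) : avoiders T S U V ≠ univ := by
  intro huniv
  obtain ⟨u, hu⟩ := hUne
  obtain ⟨v, hv⟩ := hVne
  set J := {p : X × Y | ∀ n : ℕ, ¬ (T^[n] p.1 ∈ U ∧ S^[n] p.2 ∈ V)} with hJ
  have hJc : IsClosed J := isClosed_avoiding_pairs hT hS hU hV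
  have hJinv : ∀ p ∈ J, (T p.1, S p.2) ∈ J := fun p hp n => by
    simpa only [← iterate_succ_apply] using hp (n + 1)
  have hfst : ∀ x, ∃ y, (x, y) ∈ J := fun x => huniv.ge (mem_univ x)
  obtain ⟨y, hy⟩ := hfst u
  have hsnd : IsClosed (Prod.snd '' J) := isClosedMap_snd_of_compactSpace _ hJc
  have hsub : closure (orbit S y) ⊆ Prod.snd '' J := by
    refine closure_orbit_subset hsnd ?_ ⟨_, hy, rfl⟩
    rintro _ ⟨p, hp, rfl⟩
    exact ⟨_, hJinv p hp, rfl⟩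
  have hall := hdisj J ⟨⟨_, hy⟩, hJc, hJinv, ?_, ?_⟩
  · exact (hall.ge (mem_univ (u, v)) : (u, v) ∈ J) 0 ⟨hu, hv⟩
  · exact eq_univ_of_forall fun x => let ⟨y, hy⟩ := hfst x; ⟨_, hy, rfl⟩
  · exact eq_univ_of_forall fun z => hsub (hmin y z)

end Avoiders

section Transitive

variable {X : Type*} [TopologicalSpace X] {T : X → X}

lemma IsTransitiveSys.eq_univ (hT : IsTransitiveSys T) {F U : Set X} (hF : IsClosed F)
    (hinv : MapsTo T F F) (hU : IsOpen U) (hne : U.Nonempty) (hUF : U ⊆ F) : F = univ := by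
  by_contra h
  obtain ⟨n, x, hxU, hxF⟩ :=
    (hT U Fᶜ hU hF.isOpen_compl hne (nonempty_compl.2 h)).nonempty
  exact hxF (hinv.iterate n (hUF hxU))

lemma IsTransitiveSys.dense_setOf_dense_orbit [SecondCountableTopology X] [BaireSpace X]
    (hT : IsTransitiveSys T) (hTc : Continuous T) : Dense {x | Dense (orbit T x)} := by
  have hd : Dense (⋂ B ∈ {B ∈ TopologicalSpace.countableBasis X | B.Nonempty},
      ⋃ n : ℕ, T^[n] ⁻¹' B) := by
    have hopen : ∀ B ∈ {B ∈ TopologicalSpace.countableBasis X | B.Nonempty},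
        IsOpen (⋃ n : ℕ, T^[n] ⁻¹' B) := fun B hB => isOpen_iUnion fun n =>
      (TopologicalSpace.isOpen_of_mem_countableBasis hB.1).preimage (hTc.iterate n)
    refine dense_biInter_of_isOpen hopen
      ((TopologicalSpace.countable_countableBasis X).mono fun _ h => h.1) fun B hB => ?_
    rw [dense_iff_inter_open]
    intro U hU hUne
    obtain ⟨n, x, hx, hxB⟩ := (hT U B hU
      (TopologicalSpace.isOpen_of_mem_countableBasis hB.1) hUne hB.2).nonempty
    exact ⟨x, hx, mem_iUnion.2 ⟨n, hxB⟩⟩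
  refine hd.mono fun x hx => ?_
  rw [mem_ofPred_eq, (TopologicalSpace.isBasis_countableBasis X).dense_iff]
  intro B hB hBne
  obtain ⟨n, hn⟩ := mem_iUnion.1 (mem_iInter₂.1 hx B ⟨hB, hBne⟩)
  exact ⟨_, hn, n, rfl⟩

/-- For a surjective system, nonempty hitting sets are automatically infinite. -/
lemma isTransitiveSys_of_nonempty (hTc : Continuous T) (hTs : Surjective T)
    (h : ∀ U V : Set X, IsOpen U → IsOpen V → U.Nonempty → V.Nonempty →
      ∃ n : ℕ, (U ∩ T^[n] ⁻¹' V).Nonempty) : IsTransitiveSys T := by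
  intro U V hU hV hUne hVne
  refine infinite_of_not_bddAbove ?_
  rintro ⟨K, hK⟩
  obtain ⟨n, x, hxU, hxV⟩ := h U (T^[K + 1] ⁻¹' V) hU (hV.preimage (hTc.iterate _)) hUne
    (hVne.preimage (hTs.iterate _))
  have : K + 1 + n ≤ K := hK ⟨x, hxU, by
    rw [mem_preimage, iterate_add_apply]
    exact hxV⟩
  omega

end Transitive

section Symbolic

/-- The prefix of length `L` of the sequence `w` occurs in `ω` at position `p`. -/
def OccursAt (w : ℕ → Bool) (L : ℕ) (ω : ℕ → Bool) (p : ℕ) : Prop :=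
  ∀ i < L, ω (p + i) = w i

/-- No letter `true` of the prefix of length `L` of `w`, placed at position `a`, falls in `A`. -/
def CompatibleAt (A : Set ℕ) (w : ℕ → Bool) (L a : ℕ) : Prop :=
  ∀ i < L, a + i ∈ A → w i = false

/-- The sequence equal to `ω` before position `p` and to `ω'`, placed at `p`, afterwards. -/
def glue (ω : ℕ → Bool) (p : ℕ) (ω' : ℕ → Bool) : ℕ → Bool :=
  fun i => if i < p then ω i else ω' (i - p)

variable {A : Set ℕ} {w ω ω' : ℕ → Bool} {L p i : ℕ}

lemma glue_of_lt (h : i < p) : glue ω p ω' i = ω i := if_pos h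

lemma glue_add : glue ω p ω' (p + i) = ω' i := by
  simp [glue]

lemma glue_of_lt_add (h : ∀ j < L, ω (p + j) = ω' j) (hi : i < p + L) :
    glue ω p ω' i = ω i := by
  rcases lt_or_ge i p with hip | hip
  · exact glue_of_lt hip
  · obtain ⟨j, rfl⟩ := Nat.exists_eq_add_of_le hip
    rw [glue_add, h j (by omega)]

lemma OccursAt.glue_add (h : OccursAt w L ω' i) : OccursAt w L (glue ω p ω') (p + i) :=
  fun j hj => by rw [add_assoc, _root_.glue_add, h j hj]

lemma CompatibleAt.glue {a : ℕ} (h : ∀ L, CompatibleAt A ω L a)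
    (h' : ∀ L, CompatibleAt A ω' L (a + p)) (L : ℕ) : CompatibleAt A (glue ω p ω') L a := by
  intro i _ hiA
  rcases lt_or_ge i p with hip | hip
  · rw [glue_of_lt hip]
    exact h (i + 1) i (Nat.lt_succ_self i) hiA
  · obtain ⟨j, rfl⟩ := Nat.exists_eq_add_of_le hip
    rw [glue_add]
    exact h' (j + 1) j (Nat.lt_succ_self j) (by rwa [add_assoc])

lemma isClosed_setOf_occursAt (w : ℕ → Bool) (L p : ℕ) : IsClosed {ω | OccursAt w L ω p} := by
  simp only [OccursAt, ofPred_forall]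
  exact isClosed_iInter fun i => isClosed_iInter fun _ =>
    isClosed_eq (continuous_apply _) continuous_const

lemma isClosed_setOf_compatibleAt (A : Set ℕ) (a : ℕ) :
    IsClosed {ω | ∀ L, CompatibleAt A ω L a} := by
  simp only [CompatibleAt, ofPred_forall]
  exact isClosed_iInter fun _ => isClosed_iInter fun _ => isClosed_iInter fun _ =>
    isClosed_iInter fun _ => isClosed_eq (continuous_apply _) continuous_const

lemma isClosed_setOf_exists_occursAt (w : ℕ → Bool) (L M i : ℕ) :
    IsClosed {ω | ∃ j, i ≤ j ∧ j ≤ i + M ∧ OccursAt w L ω j} := by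
  have h : {ω | ∃ j, i ≤ j ∧ j ≤ i + M ∧ OccursAt w L ω j}
      = ⋃ j ∈ Icc i (i + M), {ω | OccursAt w L ω j} := by
    ext ω
    simp [and_assoc]
  rw [h]
  exact (finite_Icc _ _).isClosed_biUnion fun j _ => isClosed_setOf_occursAt w L j

/-- A finite stage in the construction of a uniformly recurrent sequence vanishing on `A`: the
prefix of length `len` of `word` recurs with gaps at most `gap` in every member of `good`, and can
be completed to a member of `good` wherever it is compatible with `A`. -/
structure Stage (A : Set ℕ) where
  good : Set (ℕ → Bool)
  word : ℕ → Bool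
  len : ℕ
  gap : ℕ
  isClosed_good : IsClosed good
  recurs : ∀ ω ∈ good, ∀ i, ∃ j, i ≤ j ∧ j ≤ i + gap ∧ OccursAt word len ω j
  glue_mem : ∀ ω ∈ good, ∀ ω' ∈ good, ∀ p, OccursAt word len ω p → OccursAt word len ω' 0 →
    glue ω p ω' ∈ good
  extend : ∀ a, CompatibleAt A word len a →
    ∃ ω ∈ good, OccursAt word len ω 0 ∧ ∀ L, CompatibleAt A ω L a
  compatible : CompatibleAt A word len 0

def Stage.zero (A : Set ℕ) : Stage A where
  good := univ
  word := fun _ => false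
  len := 0
  gap := 0
  isClosed_good := isClosed_univ
  recurs _ _ i := ⟨i, le_rfl, le_rfl, fun _ h => absurd h (Nat.not_lt_zero _)⟩
  glue_mem _ _ _ _ _ _ _ := mem_univ _
  extend _ _ := ⟨fun _ => false, mem_univ _, fun _ h => absurd h (Nat.not_lt_zero _),
    fun _ _ _ _ => rfl⟩
  compatible _ h := absurd h (Nat.not_lt_zero _)

lemma Stage.exists_next (hA : ∀ l, ∃ N, ∀ a, ∃ b ≤ N, ∀ c < l, a + b + c ∉ A) (s : Stage A)
    {v : ℕ → Bool} {r : ℕ} (hv : v ∈ s.good) (hv0 : OccursAt s.word s.len v 0)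
    (hvr : OccursAt s.word s.len v r) (hvA : ∀ L, CompatibleAt A v L 0) :
    ∃ t : Stage A, t.good ⊆ s.good ∧ t.word = v ∧ t.len = r + s.len := by
  obtain ⟨N, hN⟩ := hA (s.gap + (r + s.len))
  set l := r + s.len with hl
  set M := 1 + l + N + s.gap with hM
  have hword_occ : ∀ {ω p}, OccursAt v l ω p → OccursAt s.word s.len ω p := by
    intro ω p h i hi
    have := hv0 i hi
    rw [zero_add] at this
    rw [h i (by omega), this]
  have hfin : ∀ n a, CompatibleAt A v l a → ∃ ω ∈ s.good, OccursAt v l ω 0 ∧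
      (∀ L, CompatibleAt A ω L a) ∧ ∀ i < n, ∃ j, i ≤ j ∧ j ≤ i + M ∧ OccursAt v l ω j := by
    intro n
    induction n with
    | zero =>
      intro a ha
      obtain ⟨ω, hω, hω0, hωA⟩ := s.extend (a + r) (fun i hi hiA => by
        rw [← hvr i hi]
        exact ha (r + i) (by omega) (by rwa [← add_assoc]))
      have hagree : ∀ j < s.len, v (r + j) = ω j := fun j hj => by
        have := hω0 j hj
        rw [zero_add] at this
        rw [hvr j hj, this]
      refine ⟨glue v r ω, s.glue_mem v hv ω hω r hvr hω0, fun i hi => ?_, fun L i hi hiA => ?_,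
        fun i hi => absurd hi (Nat.not_lt_zero i)⟩
      · rw [zero_add, glue_of_lt_add hagree hi]
      · rcases lt_or_ge i r with hir | hir
        · rw [glue_of_lt hir]
          exact ha i (by omega) hiA
        · obtain ⟨j, rfl⟩ := Nat.exists_eq_add_of_le hir
          rw [glue_add]
          exact hωA (j + 1) j (Nat.lt_succ_self j) (by rwa [add_assoc])
    | succ n ih =>
      intro a ha
      obtain ⟨ω, hω, hω0, hωA, -⟩ := ih a ha
      obtain ⟨b, hbN, hb⟩ := hN (a + (1 + l))
      obtain ⟨p, hbp, hpb, hp⟩ := s.recurs ω hω (1 + l + b)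
      obtain ⟨ω', hω', hω'0, hω'A, hω'rec⟩ := ih (a + p) (fun i hi hiA => by
        refine absurd hiA ?_
        have := hb (p - (1 + l + b) + i) (by omega)
        rwa [show a + (1 + l) + b + (p - (1 + l + b) + i) = a + p + i by omega] at this)
      refine ⟨glue ω p ω', s.glue_mem ω hω ω' hω' p hp (hword_occ hω'0), fun i hi => ?_,
        CompatibleAt.glue hωA hω'A, fun i hi => ?_⟩
      · rw [glue_of_lt (by omega)]
        exact hω0 i hi
      · rcases le_or_gt i p with hip | hip
        · exact ⟨p, hip, by omega, hω'0.glue_add⟩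
        · obtain ⟨j, hij, hji, hj⟩ := hω'rec (i - p) (by omega)
          exact ⟨p + j, by omega, by omega, hj.glue_add⟩
  refine ⟨{ good := s.good ∩ ⋂ i, {ω | ∃ j, i ≤ j ∧ j ≤ i + M ∧ OccursAt v l ω j}
            word := v
            len := l
            gap := M
            isClosed_good := s.isClosed_good.inter
              (isClosed_iInter fun i => isClosed_setOf_exists_occursAt v l M i)
            recurs := fun ω hω i => mem_iInter.1 hω.2 i
            glue_mem := ?_
            extend := ?_
            compatible := hvA l }, inter_subset_left, rfl, rfl⟩
  · rintro ω ⟨hω, hωrec⟩ ω' ⟨hω', hω'rec⟩ p hp hω'0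
    refine ⟨s.glue_mem ω hω ω' hω' p (hword_occ hp) (hword_occ hω'0), mem_iInter.2 fun i => ?_⟩
    have hagree : ∀ j < l, ω (p + j) = ω' j := fun j hj => by
      have := hω'0 j hj
      rw [zero_add] at this
      rw [hp j hj, this]
    rcases le_or_gt i p with hip | hip
    · obtain ⟨j, hij, hji, hj⟩ := mem_iInter.1 hωrec i
      rcases le_or_gt j p with hjp | hjp
      · exact ⟨j, hij, hji, fun k hk => by
          rw [glue_of_lt_add hagree (by omega)]
          exact hj k hk⟩
      · exact ⟨p, hip, by omega, hω'0.glue_add⟩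
    · obtain ⟨j, hij, hji, hj⟩ := mem_iInter.1 hω'rec (i - p)
      exact ⟨p + j, by omega, by omega, hj.glue_add⟩
  · intro a ha
    let E : ℕ → Set (ℕ → Bool) := fun n =>
      (s.good ∩ ({ω | OccursAt v l ω 0} ∩ {ω | ∀ L, CompatibleAt A ω L a})) ∩
        ⋂ i, ⋂ (_ : i < n), {ω | ∃ j, i ≤ j ∧ j ≤ i + M ∧ OccursAt v l ω j}
    have hEc : ∀ n, IsClosed (E n) := fun n =>
      (s.isClosed_good.inter ((isClosed_setOf_occursAt v l 0).inter
        (isClosed_setOf_compatibleAt A a))).inter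
        (isClosed_iInter fun i => isClosed_iInter fun _ => isClosed_setOf_exists_occursAt v l M i)
    obtain ⟨ω, hω⟩ := IsCompact.nonempty_iInter_of_sequence_nonempty_isCompact_isClosed E
      (fun n ω hω => ⟨hω.1, mem_iInter₂.2 fun i hi => mem_iInter₂.1 hω.2 i (by omega)⟩)
      (fun n => by
        obtain ⟨ω, hω, hω0, hωA, hωrec⟩ := hfin n a ha
        exact ⟨ω, ⟨hω, hω0, hωA⟩, mem_iInter₂.2 hωrec⟩)
      (hEc 0).isCompact hEc
    have hω' := mem_iInter.1 hω
    exact ⟨ω, ⟨(hω' 0).1.1, mem_iInter.2 fun i =>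
      mem_iInter₂.1 (hω' (i + 1)).2 i (Nat.lt_succ_self i)⟩, (hω' 0).1.2.1, (hω' 0).1.2.2⟩

lemma Stage.exists_extension (hA : ∀ l, ∃ N, ∀ a, ∃ b ≤ N, ∀ c < l, a + b + c ∉ A)
    (s : Stage A) : ∃ t : Stage A, t.good ⊆ s.good ∧ t.word ∈ s.good ∧
      OccursAt s.word s.len t.word 0 ∧ s.len < t.len := by
  obtain ⟨v, hv, hv0, hvA⟩ := s.extend 0 s.compatible
  obtain ⟨r, hr, -, hvr⟩ := s.recurs v hv 1
  obtain ⟨t, htg, rfl, htl⟩ := s.exists_next hA hv hv0 hvr hvA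
  exact ⟨t, htg, hv, hv0, by omega⟩

/-- A set whose complement is thickly syndetic and contains `0` misses the support of a uniformly
recurrent sequence that starts with `true`. -/
lemma exists_uniformlyRecurrent_sequence
    (hA : ∀ l, ∃ N, ∀ a, ∃ b ≤ N, ∀ c < l, a + b + c ∉ A) (h0 : 0 ∉ A) :
    ∃ y : ℕ → Bool, y 0 = true ∧ (∀ n ∈ A, y n = false) ∧
      ∀ k, ∃ M, ∀ i, ∃ j, i ≤ j ∧ j ≤ i + M ∧ OccursAt y k y j := by
  obtain ⟨s₁, -, hs₁w, hs₁l⟩ := (Stage.zero A).exists_next hA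
    (v := fun i => decide (i = 0)) (r := 1) (mem_univ _)
    (fun _ h => absurd h (Nat.not_lt_zero _)) (fun _ h => absurd h (Nat.not_lt_zero _))
    (fun L i _ hi => decide_eq_false (by rintro rfl; exact h0 hi))
  choose next hgood hword hocc hlen using fun s : Stage A => s.exists_extension hA
  let s : ℕ → Stage A := fun k => next^[k] s₁
  have hs : ∀ k, s (k + 1) = next (s k) := fun k => iterate_succ_apply' next k s₁
  have hs_len : ∀ k, k < (s k).len := by
    intro k
    induction k with
    | zero => change 0 < s₁.len; rw [hs₁l]; omega
    | succ k ih => rw [hs]; have := hlen (s k); omega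
  have hs_len_mono : ∀ {k m}, k ≤ m → (s k).len ≤ (s m).len := fun {k m} h =>
    monotone_nat_of_le_succ (f := fun k => (s k).len) (fun k => by
      change (s k).len ≤ (s (k + 1)).len
      rw [hs]; exact (hlen _).le) h
  have hs_good : ∀ {k m}, k ≤ m → (s m).good ⊆ (s k).good := fun {k m} h =>
    antitone_nat_of_succ_le (f := fun k => (s k).good) (fun k => by
      change (s (k + 1)).good ⊆ (s k).good
      rw [hs]; exact hgood _) h
  have hs_word : ∀ {k m}, k ≤ m → ∀ i < (s k).len, (s m).word i = (s k).word i := by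
    intro k m h i hi
    induction m, h using Nat.le_induction with
    | base => rfl
    | succ m hkm ih =>
      have := hocc (s m) i (hi.trans_le (hs_len_mono hkm))
      rw [zero_add] at this
      rw [hs, this, ih]
  set y : ℕ → Bool := fun i => (s i).word i with hy
  have hy_word : ∀ k, ∀ i < (s k).len, y i = (s k).word i := by
    intro k i hi
    rcases le_total i k with h | h
    · exact (hs_word h i (hs_len i)).symm
    · exact hs_word h i hi
  refine ⟨y, ?_, fun n hn => ?_, fun k => ⟨(s k).gap, fun i => ?_⟩⟩
  · change s₁.word 0 = true
    rw [hs₁w]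
    rfl
  · exact (s n).compatible n (hs_len n) (by rwa [zero_add])
  · set m := i + (s k).gap + k + 1 with hm
    have hmem : (s m).word ∈ (s k).good := by
      rw [hm, hs]
      exact hs_good (by omega) (hword _)
    obtain ⟨j, hij, hji, hj⟩ := (s k).recurs _ hmem i
    refine ⟨j, hij, hji, fun c hc => ?_⟩
    have hck : c < (s k).len := hc.trans (hs_len k)
    rw [hy_word m (j + c) (by have := hs_len m; omega), hj c hck, hy_word k c hck]

lemma iterate_shift_apply (y : ℕ → Bool) (n i : ℕ) :
    (fun (z : ℕ → Bool) i => z (i + 1))^[n] y i = y (n + i) := by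
  induction n generalizing y with
  | zero => simp
  | succ n ih => rw [iterate_succ_apply, ih]; congr 1; omega

lemma isMinimalPoint_shift_of_uniformlyRecurrent {y : ℕ → Bool}
    (hy : ∀ k, ∃ M, ∀ i, ∃ j, i ≤ j ∧ j ≤ i + M ∧ OccursAt y k y j) :
    IsMinimalPoint (fun (z : ℕ → Bool) i => z (i + 1)) y := by
  set σ : (ℕ → Bool) → ℕ → Bool := fun z i => z (i + 1) with hσ
  have hσc : Continuous σ := continuous_pi fun i => continuous_apply (i + 1)
  intro z hz
  refine closure_orbit_subset isClosed_closure (mapsTo_closure_orbit hσc z) ?_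
  have hocc : ∀ k, ∃ j, OccursAt y k z j := by
    intro k
    obtain ⟨M, hM⟩ := hy k
    have hsub : closure (orbit σ y) ⊆ {z | ∃ j, 0 ≤ j ∧ j ≤ 0 + M ∧ OccursAt y k z j} := by
      refine closure_minimal ?_ (isClosed_setOf_exists_occursAt y k M 0)
      rintro _ ⟨n, rfl⟩
      obtain ⟨j, hnj, hjn, hj⟩ := hM n
      refine ⟨j - n, Nat.zero_le _, by omega, fun c hc => ?_⟩
      refine (iterate_shift_apply y n _).trans ?_
      rw [← hj c hc]
      congr 1
      omega
    obtain ⟨j, -, -, hj⟩ := hsub hz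
    exact ⟨j, hj⟩
  choose j hj using hocc
  refine mem_closure_of_tendsto (f := fun k => σ^[j k] z) (b := atTop) ?_
    (Eventually.of_forall fun k => ⟨j k, rfl⟩)
  refine tendsto_pi_nhds.2 fun i => tendsto_const_nhds.congr' ?_
  filter_upwards [eventually_gt_atTop i] with k hk
  rw [iterate_shift_apply, hj k i hk]

end Symbolic

lemma iterate_prod_self_apply {X : Type*} (T : X → X) (n : ℕ) (p : X × X) :
    (fun p : X × X => (T p.1, T p.2))^[n] p = (T^[n] p.1, T^[n] p.2) := by
  change (Prod.map T T)^[n] p = _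
  rw [Prod.map_iterate]
  rfl

section Disjointness

/-- If no minimal point lies in `U`, then visits to a closed subset of `U` avoid arbitrarily long
intervals with bounded gaps. -/
lemma exists_gap_of_forall_not_isMinimalPoint {X : Type*} [MetricSpace X] [CompactSpace X]
    {T : X → X} (hTc : Continuous T) {C : Set X} (hC : IsClosed C)
    (hno : ∀ x ∈ C, ¬ IsMinimalPoint T x) (x : X) (l : ℕ) :
    ∃ N, ∀ a, ∃ b ≤ N, ∀ c < l, T^[a + b + c] x ∉ C := by
  by_contra! h
  choose a ha using h
  obtain ⟨x', -, φ, hφ, hlim⟩ := isCompact_univ.tendsto_subseq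
    (fun N => mem_univ (T^[a N] x))
  set Z : Set X := ⋂ b : ℕ, ⋃ c ∈ Iio l, T^[b + c] ⁻¹' C with hZ
  have hmemZ : ∀ {z}, z ∈ Z ↔ ∀ b, ∃ c < l, T^[b + c] z ∈ C := by
    simp [hZ]
  have hGc : ∀ b : ℕ, IsClosed (⋃ c ∈ Iio l, T^[b + c] ⁻¹' C) := fun b =>
    (finite_Iio l).isClosed_biUnion fun c _ => hC.preimage (hTc.iterate _)
  have hx' : x' ∈ Z := by
    refine mem_iInter.2 fun b => (hGc b).mem_of_tendsto hlim ?_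
    filter_upwards [hφ.tendsto_atTop.eventually_ge_atTop b] with N hN
    obtain ⟨c, hc, hcC⟩ := ha (φ N) b hN
    refine mem_iUnion₂.2 ⟨c, hc, ?_⟩
    rw [mem_preimage, comp_apply, ← iterate_add_apply]
    rwa [show b + c + a (φ N) = a (φ N) + b + c by omega]
  obtain ⟨m, hmZ, hm⟩ := exists_isMinimalPoint_mem hTc (isClosed_iInter hGc) ⟨x', hx'⟩
    (fun z hz => hmemZ.2 fun b => by
      obtain ⟨c, hc, hcC⟩ := hmemZ.1 hz (b + 1)
      refine ⟨c, hc, ?_⟩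
      rwa [← iterate_succ_apply, show (b + c).succ = b + 1 + c by omega])
  obtain ⟨c, -, hcC⟩ := hmemZ.1 hmZ 0
  exact hno _ hcC (hm.of_mem_closure_orbit hTc (subset_closure ⟨_, rfl⟩))

variable {X : Type} [MetricSpace X] [CompactSpace X] {T : X → X}

lemma dense_setOf_isMinimalPoint (hTc : Continuous T) (hTtr : IsTransitiveSys T)
    (hdisj : ∀ 𝒴 : TDS, IsMinimalSys 𝒴.map → DisjointSys T 𝒴.map) :
    Dense {x | IsMinimalPoint T x} := by
  rw [dense_iff_inter_open]
  rintro U hU ⟨u, hu⟩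
  by_contra hempty
  have hno : ∀ x ∈ U, ¬ IsMinimalPoint T x := fun x hxU hx => hempty ⟨x, hxU, hx⟩
  obtain ⟨C, hCu, hC, hCU⟩ := exists_mem_nhds_isClosed_subset (hU.mem_nhds hu)
  obtain ⟨m, -, hm⟩ := exists_isMinimalPoint_mem hTc isClosed_univ ⟨u, mem_univ u⟩
    (mapsTo_univ T univ)
  obtain ⟨x, hxC, hx⟩ := (hTtr.dense_setOf_dense_orbit hTc).inter_open_nonempty Cᶜ
    hC.isOpen_compl ⟨m, fun h => hno m (hCU h) hm⟩
  obtain ⟨y, hy0, hyA, hyrec⟩ := exists_uniformlyRecurrent_sequence (A := {n | T^[n] x ∈ C})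
    (exists_gap_of_forall_not_isMinimalPoint hTc hC (fun z hz => hno z (hCU hz)) x) hxC
  let _ := TopologicalSpace.metrizableSpaceMetric (ℕ → Bool)
  obtain ⟨𝒴, hmin, π, z, hπ, hπS, rfl⟩ :=
    (isMinimalPoint_shift_of_uniformlyRecurrent hyrec).exists_minimal_system
      (continuous_pi fun i => continuous_apply (i + 1))
  have hV : IsOpen {w | π w 0 = true} :=
    (isOpen_discrete {true}).preimage ((continuous_apply 0).comp hπ)
  refine avoiders_ne_univ hTc 𝒴.cont hmin (hdisj 𝒴 hmin) isOpen_interior hV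
    ⟨u, mem_interior_iff_mem_nhds.2 hCu⟩ ⟨z, hy0⟩ (eq_univ_of_forall fun x' => ?_)
  refine closure_orbit_subset (isClosed_avoiders hTc 𝒴.cont isOpen_interior hV)
    mapsTo_avoiders ⟨z, fun n hn => ?_⟩ (hx x')
  have h1 : π (𝒴.map^[n] z) 0 = true := hn.2
  rw [hπS, iterate_shift_apply, add_zero, hyA n (interior_subset (s := C) hn.1)] at h1
  exact Bool.false_ne_true h1

lemma isWeaklyMixingSys_of_disjoint (hTc : Continuous T) (hTs : Surjective T)
    (hTtr : IsTransitiveSys T)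
    (hdisj : ∀ 𝒴 : TDS, IsMinimalSys 𝒴.map → DisjointSys T 𝒴.map) :
    IsWeaklyMixingSys T := by
  have hret : ∀ U V W : Set X, IsOpen U → IsOpen V → IsOpen W → U.Nonempty → V.Nonempty →
      W.Nonempty → ∃ n : ℕ, (U ∩ T^[n] ⁻¹' V).Nonempty ∧ (W ∩ T^[n] ⁻¹' W).Nonempty := by
    intro U V W hU hV hW hUne hVne hWne
    obtain ⟨d, hdW, hd⟩ :=
      (dense_setOf_isMinimalPoint hTc hTtr hdisj).inter_open_nonempty W hW hWne
    obtain ⟨𝒴, hmin, π, y, hπ, hπS, rfl⟩ := IsMinimalPoint.exists_minimal_system hTc hd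
    by_contra! h
    have hWπ : IsOpen (π ⁻¹' W) := hW.preimage hπ
    refine avoiders_ne_univ hTc 𝒴.cont hmin (hdisj 𝒴 hmin) hV hWπ hVne ⟨y, hdW⟩
      (hTtr.eq_univ (isClosed_avoiders hTc 𝒴.cont hV hWπ) mapsTo_avoiders hU hUne
        fun x hxU => ⟨y, fun n hn => ?_⟩)
    have hnW : T^[n] (π y) ∈ W := by
      rw [← hπS]
      exact hn.2
    exact (h n ⟨x, hxU, hn.1⟩).le ⟨hdW, hnW⟩
  refine isTransitiveSys_of_nonempty (hTc.prodMap hTc) (hTs.prodMap hTs) ?_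
  rintro P Q hP hQ ⟨⟨u₁, u₂⟩, hu⟩ ⟨⟨v₁, v₂⟩, hv⟩
  obtain ⟨U₁, U₂, hU₁, hU₂, hu₁, hu₂, hUP⟩ := isOpen_prod_iff.1 hP u₁ u₂ hu
  obtain ⟨V₁, V₂, hV₁, hV₂, hv₁, hv₂, hVQ⟩ := isOpen_prod_iff.1 hQ v₁ v₂ hv
  obtain ⟨k, hk⟩ := (hTtr U₂ V₂ hU₂ hV₂ ⟨u₂, hu₂⟩ ⟨v₂, hv₂⟩).nonempty
  obtain ⟨n, ⟨x, hxU, hxV⟩, w, ⟨hw, -⟩, -, hwV⟩ := hret U₁ (T^[k] ⁻¹' V₁)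
    (U₂ ∩ T^[k] ⁻¹' V₂) hU₁ (hV₁.preimage (hTc.iterate k))
    (hU₂.inter (hV₂.preimage (hTc.iterate k))) ⟨u₁, hu₁⟩
    (Set.Nonempty.preimage ⟨v₁, hv₁⟩ (hTs.iterate k)) hk
  refine ⟨k + n, (x, w), hUP ⟨hxU, hw⟩, hVQ ?_⟩
  rw [iterate_prod_self_apply]
  simp only [iterate_add_apply]
  exact ⟨hxV, hwV⟩

/-- If `T` is disjoint from a minimal system `S`, then any dense set of minimal points of `T`
contains points whose visits to `U` are syndetically synchronized with visits of `y` to `V`. -/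
lemma exists_syndetic_of_disjoint (hTc : Continuous T) (hTtr : IsTransitiveSys T) {Y : Type*}
    [MetricSpace Y] [CompactSpace Y] {S : Y → Y} (hSc : Continuous S) (hmin : IsMinimalSys S)
    (hdisj : DisjointSys T S) {D : Set X} (hD : Dense D) (hDmin : ∀ x ∈ D, IsMinimalPoint T x)
    {U : Set X} {V : Set Y} (hU : IsOpen U) (hV : IsOpen V) (hUne : U.Nonempty) {y : Y}
    (hy : y ∈ V) : ∃ x ∈ D ∩ U, Syndetic {n : ℕ | T^[n] x ∈ U ∧ S^[n] y ∈ V} := by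
  by_contra! h
  have hclosed : IsClosed (avoiders T S U V) := isClosed_avoiders hTc hSc hU hV
  refine avoiders_ne_univ hTc hSc hmin hdisj hU hV hUne ⟨y, hy⟩
    (hTtr.eq_univ hclosed mapsTo_avoiders hU hUne ?_)
  refine (hD.open_subset_closure_inter hU).trans (closure_minimal ?_ hclosed)
  rintro d ⟨hdU, hdD⟩
  have hd := h d ⟨hdD, hdU⟩
  simp only [Syndetic, not_exists, not_forall, not_and, mem_ofPred_eq] at hd
  choose a ha using hd
  obtain ⟨⟨x', y'⟩, -, φ, hφ, hlim⟩ := isCompact_univ.tendsto_subseq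
    (fun N => mem_univ ((T^[a N] d, S^[a N] y) : X × Y))
  have hx' : x' ∈ closure (orbit T d) :=
    mem_closure_of_tendsto ((continuous_fst.tendsto _).comp hlim)
      (Eventually.of_forall fun N => ⟨a (φ N), rfl⟩)
  have hav : x' ∈ avoiders T S U V := by
    refine ⟨y', fun n hn => ?_⟩
    have hopen : IsOpen ((T^[n] ⁻¹' U) ×ˢ (S^[n] ⁻¹' V)) :=
      (hU.preimage (hTc.iterate n)).prod (hV.preimage (hSc.iterate n))
    obtain ⟨N, hNU, hN⟩ := ((hlim.eventually (hopen.mem_nhds ⟨hn.1, hn.2⟩)).and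
      (hφ.tendsto_atTop.eventually_ge_atTop n)).exists
    refine ha (φ N) n hN ?_ ?_
    · rw [add_comm, iterate_add_apply]
      exact hNU.1
    · rw [add_comm, iterate_add_apply]
      exact hNU.2
  exact closure_orbit_subset hclosed mapsTo_avoiders hav
    (hDmin d hdD x' hx' (self_mem_closure_orbit T d))

end Disjointness

section WeakMixing

/-- Furstenberg's intersection lemma. -/
lemma IsWeaklyMixingSys.exists_forall_nonempty {X : Type*} [TopologicalSpace X] {T : X → X}
    (hT : IsWeaklyMixingSys T) (hTc : Continuous T) {ι : Type*} (s : Finset ι) {U : Set X}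
    (hU : IsOpen U) (hUne : U.Nonempty) (V : ι → Set X) (hV : ∀ i ∈ s, IsOpen (V i))
    (hVne : ∀ i ∈ s, (V i).Nonempty) : ∃ n : ℕ, ∀ i ∈ s, (U ∩ T^[n] ⁻¹' V i).Nonempty := by
  have hpair : ∀ U₁ U₂ V₁ V₂ : Set X, IsOpen U₁ → IsOpen U₂ → IsOpen V₁ → IsOpen V₂ →
      U₁.Nonempty → U₂.Nonempty → V₁.Nonempty → V₂.Nonempty →
      ∃ n : ℕ, (U₁ ∩ T^[n] ⁻¹' V₁).Nonempty ∧ (U₂ ∩ T^[n] ⁻¹' V₂).Nonempty := by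
    intro U₁ U₂ V₁ V₂ hU₁ hU₂ hV₁ hV₂ hU₁ne hU₂ne hV₁ne hV₂ne
    obtain ⟨n, p, hpU, hpV⟩ := (hT (U₁ ×ˢ U₂) (V₁ ×ˢ V₂) (hU₁.prod hU₂) (hV₁.prod hV₂)
      (hU₁ne.prod hU₂ne) (hV₁ne.prod hV₂ne)).nonempty
    rw [mem_preimage, iterate_prod_self_apply] at hpV
    exact ⟨n, ⟨p.1, hpU.1, hpV.1⟩, p.2, hpU.2, hpV.2⟩
  suffices h : ∃ A B : Set X, IsOpen A ∧ IsOpen B ∧ A.Nonempty ∧ B.Nonempty ∧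
      ∀ n : ℕ, (A ∩ T^[n] ⁻¹' B).Nonempty → ∀ i ∈ s, (U ∩ T^[n] ⁻¹' V i).Nonempty by
    obtain ⟨A, B, hA, hB, hAne, hBne, h⟩ := h
    obtain ⟨n, hn, -⟩ := hpair A A B B hA hA hB hB hAne hAne hBne hBne
    exact ⟨n, h n hn⟩
  classical
  induction s using Finset.induction_on with
  | empty => exact ⟨U, U, hU, hU, hUne, hUne, fun _ _ i hi => absurd hi (Finset.notMem_empty i)⟩
  | insert i s _ ih =>
    obtain ⟨A, B, hA, hB, hAne, hBne, h⟩ := ih (fun j hj => hV j (Finset.mem_insert_of_mem hj))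
      (fun j hj => hVne j (Finset.mem_insert_of_mem hj))
    have hVi := hV i (Finset.mem_insert_self i s)
    obtain ⟨k, hkA, hkB⟩ := hpair A B U (V i) hA hB hU hVi hAne hBne hUne
      (hVne i (Finset.mem_insert_self i s))
    refine ⟨A ∩ T^[k] ⁻¹' U, B ∩ T^[k] ⁻¹' V i, hA.inter (hU.preimage (hTc.iterate k)),
      hB.inter (hVi.preimage (hTc.iterate k)), hkA, hkB, ?_⟩
    rintro n ⟨x, ⟨hxA, hxU⟩, hxB, hxV⟩ j hj
    rcases Finset.mem_insert.1 hj with rfl | hj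
    · refine ⟨T^[k] x, hxU, ?_⟩
      rw [mem_preimage, ← iterate_add_apply, add_comm, iterate_add_apply]
      exact hxV
    · exact h n ⟨x, hxA, hxB⟩ j hj

variable {X : Type*} [MetricSpace X] [CompactSpace X] {T : X → X}

lemma IsWeaklyMixingSys.dense_setOf_exists_dist_lt (hT : IsWeaklyMixingSys T)
    (hTc : Continuous T) (x : X) {ε : ℝ} (hε : 0 < ε) :
    Dense {z | ∃ n : ℕ, dist (T^[n] z) (T^[n] x) < ε} := by
  rw [dense_iff_inter_open]
  intro U hU hUne
  obtain ⟨t, -, ht⟩ := isCompact_univ.elim_nhds_subcover (fun c : X => Metric.ball c (ε / 2))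
    (fun c _ => Metric.ball_mem_nhds c (half_pos hε))
  obtain ⟨n, hn⟩ := hT.exists_forall_nonempty hTc t hU hUne
    (fun c => Metric.ball c (ε / 2)) (fun _ _ => Metric.isOpen_ball)
    (fun c _ => ⟨c, Metric.mem_ball_self (half_pos hε)⟩)
  obtain ⟨c, hct, hc⟩ := mem_iUnion₂.1 (ht (mem_univ (T^[n] x)))
  obtain ⟨z, hzU, hz⟩ := hn c hct
  refine ⟨z, hzU, n, (dist_triangle_right _ _ c).trans_lt ?_⟩
  have h1 : dist (T^[n] z) c < ε / 2 := hz
  have h2 : dist (T^[n] x) c < ε / 2 := hc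
  linarith

/-- In a weakly mixing system some point is proximal to all points of a given countable set. -/
lemma IsWeaklyMixingSys.exists_forall_proximal [Nonempty X] (hT : IsWeaklyMixingSys T)
    (hTc : Continuous T) {D : Set X} (hD : D.Countable) :
    ∃ z, ∀ x ∈ D, ∀ ε > 0, ∃ n : ℕ, dist (T^[n] z) (T^[n] x) < ε := by
  have hdense : Dense (⋂ x ∈ D, ⋂ k : ℕ,
      {z | ∃ n : ℕ, dist (T^[n] z) (T^[n] x) < 1 / (k + 1)}) := by
    have hopen : ∀ (x : X) (ε : ℝ), IsOpen {z | ∃ n : ℕ, dist (T^[n] z) (T^[n] x) < ε} := by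
      intro x ε
      simp only [ofPred_exists]
      exact isOpen_iUnion fun n => isOpen_lt ((hTc.iterate n).dist continuous_const)
        continuous_const
    refine dense_biInter_of_Gδ (fun x _ => IsGδ.iInter_of_isOpen fun k => hopen x _) hD
      fun x _ => dense_iInter_of_isOpen (fun k => hopen x _)
        fun k => hT.dense_setOf_exists_dist_lt hTc x Nat.one_div_pos_of_nat
  obtain ⟨z, hz⟩ := hdense.nonempty
  refine ⟨z, fun x hx ε hε => ?_⟩
  obtain ⟨k, hk⟩ := exists_nat_one_div_lt hε
  obtain ⟨n, hn⟩ := mem_iInter.1 (mem_iInter₂.1 hz x hx) k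
  exact ⟨n, hn.trans hk⟩

/-- Proximal points shadow each other along a thick set, hence along some time of any given
syndetic set. -/
lemma exists_mem_dist_lt_of_syndetic (hTc : Continuous T) {z x : X}
    (hprox : ∀ ε > 0, ∃ n : ℕ, dist (T^[n] z) (T^[n] x) < ε) {A : Set ℕ} (hA : Syndetic A)
    {ε : ℝ} (hε : 0 < ε) : ∃ n ∈ A, dist (T^[n] z) (T^[n] x) < ε := by
  obtain ⟨N, hN⟩ := hA
  have huc : ∀ j : ℕ, ∃ δ > 0, ∀ {a b : X}, dist a b < δ → dist (T^[j] a) (T^[j] b) < ε :=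
    fun j => Metric.uniformContinuous_iff.1
      (CompactSpace.uniformContinuous_of_continuous (hTc.iterate j)) ε hε
  choose δ hδ hδT using huc
  obtain ⟨m, hm⟩ := hprox ((Finset.range (N + 1)).inf' Finset.nonempty_range_add_one δ)
    ((Finset.lt_inf'_iff _).2 fun j _ => hδ j)
  obtain ⟨j, hj, hjA⟩ := hN m
  refine ⟨m + j, hjA, ?_⟩
  rw [add_comm, iterate_add_apply, iterate_add_apply]
  exact hδT j (hm.trans_le (Finset.inf'_le _ (Finset.mem_range.2 (by omega))))

lemma disjointSys_of_exists_syndetic (hT : IsWeaklyMixingSys T) (hTc : Continuous T)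
    (hTs : Surjective T) {D : Set X} (hD : D.Countable) {Y : Type*} [TopologicalSpace Y]
    {S : Y → Y} (hSc : Continuous S) (hmin : IsMinimalSys S)
    (h : ∀ (y : Y) (V : Set Y), IsOpen V → y ∈ V → ∀ U : Set X, IsOpen U → U.Nonempty →
      ∃ x ∈ D ∩ U, Syndetic {n : ℕ | T^[n] x ∈ U ∧ S^[n] y ∈ V}) : DisjointSys T S := by
  rintro J ⟨⟨⟨x₀, -⟩, -⟩, hJc, hJinv, hJfst, -⟩
  have : Nonempty X := ⟨x₀⟩
  obtain ⟨z, hz⟩ := hT.exists_forall_proximal hTc hD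
  obtain ⟨⟨z', y⟩, hzy, hz'⟩ := hJfst.ge (mem_univ z)
  obtain rfl : z' = z := hz'
  have hJiter : ∀ n : ℕ, (T^[n] z', S^[n] y) ∈ J := by
    intro n
    induction n with
    | zero => exact hzy
    | succ n ih =>
      rw [iterate_succ_apply', iterate_succ_apply']
      exact hJinv _ ih
  by_contra hne
  obtain ⟨⟨u, v⟩, huv⟩ := nonempty_compl.2 hne
  obtain ⟨U, V, hU, hV, hu, hv, hUV⟩ := isOpen_prod_iff.1 hJc.isOpen_compl u v huv
  obtain ⟨_, hmV, m, rfl⟩ := (hmin y).inter_open_nonempty V hV ⟨v, hv⟩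
  obtain ⟨u', rfl⟩ := hTs.iterate m u
  have hpre : T^[m] ⁻¹' U ∈ 𝓝 u' := (hU.preimage (hTc.iterate m)).mem_nhds hu
  obtain ⟨ε, hε, hball⟩ := Metric.mem_nhds_iff.1 hpre
  obtain ⟨x, ⟨hxD, -⟩, hx⟩ := h y (S^[m] ⁻¹' V) (hV.preimage (hSc.iterate m)) hmV
    (Metric.ball u' (ε / 2)) Metric.isOpen_ball ⟨u', Metric.mem_ball_self (half_pos hε)⟩
  obtain ⟨n, ⟨hnx, hnV⟩, hn⟩ := exists_mem_dist_lt_of_syndetic hTc (hz x hxD) hx (half_pos hε)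
  have hzU : T^[n] z' ∈ Metric.ball u' ε := by
    have h1 : dist (T^[n] x) u' < ε / 2 := hnx
    have h2 := dist_triangle (T^[n] z') (T^[n] x) u'
    rw [Metric.mem_ball]
    linarith
  refine hUV (a := (T^[m + n] z', S^[m + n] y)) ?_ (hJiter _)
  rw [iterate_add_apply, iterate_add_apply]
  exact ⟨hball hzU, hnV⟩

end WeakMixing

theorem stmt_1 {X : Type} [MetricSpace X] [CompactSpace X] (T : X → X)
    (hTc : Continuous T) (hTs : Function.Surjective T) (hTtr : IsTransitiveSys T) :
    (∀ 𝒴 : TDS, IsMinimalSys 𝒴.map → DisjointSys T 𝒴.map) ↔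
      (IsWeaklyMixingSys T ∧ ∃ D : Set X, D.Countable ∧ Dense D ∧
        (∀ x ∈ D, IsMinimalPoint T x) ∧
        ∀ 𝒴 : TDS, IsMinimalSys 𝒴.map →
          ∀ (y : 𝒴.carrier) (V : Set 𝒴.carrier), IsOpen V → y ∈ V →
            ∀ U : Set X, IsOpen U → U.Nonempty →
              ∃ x ∈ D ∩ U, Syndetic {n : ℕ | T^[n] x ∈ U ∧ 𝒴.map^[n] y ∈ V}) := by
  constructor
  · intro hdisj
    obtain ⟨D, hDsub, hDc, hDdense⟩ :=
      (dense_setOf_isMinimalPoint hTc hTtr hdisj).exists_countable_dense_subset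
    exact ⟨isWeaklyMixingSys_of_disjoint hTc hTs hTtr hdisj, D, hDc, hDdense, hDsub,
      fun 𝒴 hmin y V hV hy U hU hUne => exists_syndetic_of_disjoint hTc hTtr 𝒴.cont hmin
        (hdisj 𝒴 hmin) hDdense hDsub hU hV hUne hy⟩
  · rintro ⟨hwm, D, hDc, -, -, h⟩ 𝒴 hmin
    exact disjointSys_of_exists_syndetic hwm hTc hTs hDc 𝒴.cont hmin (h 𝒴 hmin)
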